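/- arXiv:1307.1671 — 2 statements merged into one kernel-verified Lean document; each statement's English description precedes it below -/
import Mathlib

section
/- Let A ∈ ℝ^{n×n}, C ∈ ℝ^{m×n}, N ≥ 1 with W := [Cᵀ, AᵀCᵀ, …, A^{(N−1)T}Cᵀ]ᵀ of full column rank n, and R ∈ ℝ^{m×m} symmetric positive definite. Define Q := Σ_{i=0}^{N−2} A^{iT} Cᵀ R C A^i and H := A^{(N−1)T} Cᵀ R C A^{N−1}. Let z, x̃ ∈ ℝ^n, set y := C A^{N−1} x̃, and let η := (Q+H)^{−1} A^{(N−1)T} Cᵀ R y + (Q+H)^{−1} Q z (the minimizer of J(·, z, y)). Then J(η, z, y) + (η − x̃)ᵀ (Q+H) (η − x̃) = (z − x̃)ᵀ Q (z − x̃), where J(ξ, z, y) := ‖C A^{N−1} ξ − y‖²_R + Σ_{i=0}^{N−2} ‖C A^i ξ − C A^i z‖²_R. -/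
open Matrix Filter Finset

/-- `‖v‖²_R = vᵀ R v`. -/
noncomputable def quadForm {m : ℕ} (R : Matrix (Fin m) (Fin m) ℝ) (v : Fin m → ℝ) : ℝ :=
  v ⬝ᵥ R.mulVec v

/-- The cost `J(ξ, z, y) = ‖C A^{N-1} ξ - y‖²_R + Σ_{i=0}^{N-2} ‖C A^i ξ - C A^i z‖²_R`. -/
noncomputable def Jcost {n m : ℕ} (A : Matrix (Fin n) (Fin n) ℝ) (C : Matrix (Fin m) (Fin n) ℝ)
    (R : Matrix (Fin m) (Fin m) ℝ) (N : ℕ) (ξ z : Fin n → ℝ) (y : Fin m → ℝ) : ℝ :=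
  quadForm R ((C * A ^ (N - 1)).mulVec ξ - y) +
    ∑ i ∈ Finset.range (N - 1), quadForm R ((C * A ^ i).mulVec ξ - (C * A ^ i).mulVec z)

/-- `Q := Σ_{i=0}^{N-2} A^{iT} Cᵀ R C A^i`. -/
noncomputable def Qmat {n m : ℕ} (A : Matrix (Fin n) (Fin n) ℝ) (C : Matrix (Fin m) (Fin n) ℝ)
    (R : Matrix (Fin m) (Fin m) ℝ) (N : ℕ) : Matrix (Fin n) (Fin n) ℝ :=
  ∑ i ∈ Finset.range (N - 1), (A ^ i)ᵀ * Cᵀ * R * C * A ^ i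

/-- `H := A^{(N-1)T} Cᵀ R C A^{N-1}`. -/
noncomputable def Hmat {n m : ℕ} (A : Matrix (Fin n) (Fin n) ℝ) (C : Matrix (Fin m) (Fin n) ℝ)
    (R : Matrix (Fin m) (Fin m) ℝ) (N : ℕ) : Matrix (Fin n) (Fin n) ℝ :=
  (A ^ (N - 1))ᵀ * Cᵀ * R * C * A ^ (N - 1)

theorem mulVec_injective_of_rank_eq {ι : Type*} [Fintype ι] {n : ℕ} (M : Matrix ι (Fin n) ℝ)
    (h : M.rank = n) : Function.Injective M.mulVec := by
  rw [Matrix.mulVec_injective_iff, linearIndependent_iff_card_eq_finrank_span, Set.finrank,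
    ← Matrix.rank_eq_finrank_span_cols, h, Fintype.card_fin]

theorem dotProduct_gram_mulVec {n m : ℕ} (A : Matrix (Fin n) (Fin n) ℝ)
    (C : Matrix (Fin m) (Fin n) ℝ) (R : Matrix (Fin m) (Fin m) ℝ) (i : ℕ) (v : Fin n → ℝ) :
    v ⬝ᵥ ((A ^ i)ᵀ * Cᵀ * R * C * A ^ i).mulVec v = quadForm R ((C * A ^ i).mulVec v) := by
  rw [quadForm, ← Matrix.vecMul_transpose (C * A ^ i), ← Matrix.dotProduct_mulVec,
    Matrix.vecMul_transpose, Matrix.mulVec_mulVec, Matrix.mulVec_mulVec, Matrix.transpose_mul]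
  simp only [Matrix.mul_assoc]

theorem dotProduct_Qmat_mulVec {n m : ℕ} (A : Matrix (Fin n) (Fin n) ℝ)
    (C : Matrix (Fin m) (Fin n) ℝ) (R : Matrix (Fin m) (Fin m) ℝ) (N : ℕ) (v : Fin n → ℝ) :
    v ⬝ᵥ (Qmat A C R N).mulVec v =
      ∑ i ∈ Finset.range (N - 1), quadForm R ((C * A ^ i).mulVec v) := by
  simp only [Qmat, Matrix.sum_mulVec, dotProduct_sum, dotProduct_gram_mulVec]

theorem Qmat_transpose {n m : ℕ} (A : Matrix (Fin n) (Fin n) ℝ) (C : Matrix (Fin m) (Fin n) ℝ)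
    (R : Matrix (Fin m) (Fin m) ℝ) (hR : Rᵀ = R) (N : ℕ) :
    (Qmat A C R N)ᵀ = Qmat A C R N := by
  simp only [Qmat, Matrix.transpose_sum, Matrix.transpose_mul, Matrix.transpose_transpose, hR,
    Matrix.mul_assoc]

theorem quadForm_pos {m : ℕ} {R : Matrix (Fin m) (Fin m) ℝ} (hR : R.PosDef) {v : Fin m → ℝ}
    (hv : v ≠ 0) : 0 < quadForm R v := by
  simpa [quadForm] using hR.dotProduct_mulVec_pos hv

theorem quadForm_nonneg {m : ℕ} {R : Matrix (Fin m) (Fin m) ℝ} (hR : R.PosDef)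
    (v : Fin m → ℝ) : 0 ≤ quadForm R v := by
  simpa [quadForm] using hR.posSemidef.dotProduct_mulVec_nonneg v

theorem Qmat_add_Hmat {n m : ℕ} (A : Matrix (Fin n) (Fin n) ℝ) (C : Matrix (Fin m) (Fin n) ℝ)
    (R : Matrix (Fin m) (Fin m) ℝ) {N : ℕ} (hN : 1 ≤ N) :
    Qmat A C R N + Hmat A C R N = Qmat A C R (N + 1) := by
  obtain ⟨k, rfl⟩ := Nat.exists_eq_add_of_le' hN
  simp [Qmat, Hmat, Finset.sum_range_succ]

theorem isUnit_det_Qmat_succ {n m : ℕ} (A : Matrix (Fin n) (Fin n) ℝ)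
    (C : Matrix (Fin m) (Fin n) ℝ) (N : ℕ)
    (hW : (Matrix.of fun (p : Fin N × Fin m) (j : Fin n) =>
      (C * A ^ (p.1 : ℕ)) p.2 j).rank = n)
    (R : Matrix (Fin m) (Fin m) ℝ) (hR : R.PosDef) :
    IsUnit (Qmat A C R (N + 1)).det := by
  rw [isUnit_iff_ne_zero]
  intro hdet
  obtain ⟨v, hv, hker⟩ := Matrix.exists_mulVec_eq_zero_iff.mpr hdet
  have hsum := dotProduct_Qmat_mulVec A C R (N + 1) v
  rw [hker, dotProduct_zero, eq_comm, Nat.add_sub_cancel,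
    Finset.sum_eq_zero_iff_of_nonneg fun i _ => quadForm_nonneg hR _] at hsum
  refine hv (mulVec_injective_of_rank_eq _ hW ?_)
  rw [Matrix.mulVec_zero]
  ext ⟨i, j⟩
  have hi : (C * A ^ (i : ℕ)).mulVec v = 0 := by
    by_contra h
    exact (quadForm_pos hR h).ne' (hsum i (Finset.mem_range.mpr i.isLt))
  exact congrFun hi j

/-- **The key identity (eqn. `eqn:aramis`).**
With `y = C A^{N-1} x̃` and `η` the optimal estimate,
`J(η, z, y) + (η - x̃)ᵀ (Q+H) (η - x̃) = (z - x̃)ᵀ Q (z - x̃)`. -/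
theorem stmt_4 {n m : ℕ} (A : Matrix (Fin n) (Fin n) ℝ) (C : Matrix (Fin m) (Fin n) ℝ)
    (N : ℕ) (hN : 1 ≤ N)
    (hW : (Matrix.of fun (p : Fin N × Fin m) (j : Fin n) =>
      (C * A ^ (p.1 : ℕ)) p.2 j).rank = n)
    (R : Matrix (Fin m) (Fin m) ℝ) (hR : R.PosDef)
    (z xt : Fin n → ℝ) (y : Fin m → ℝ) (hy : y = (C * A ^ (N - 1)).mulVec xt)
    (η : Fin n → ℝ)
    (hη : η = ((Qmat A C R N + Hmat A C R N)⁻¹ * (A ^ (N - 1))ᵀ * Cᵀ * R).mulVec y +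
        ((Qmat A C R N + Hmat A C R N)⁻¹ * Qmat A C R N).mulVec z) :
    Jcost A C R N η z y +
        (η - xt) ⬝ᵥ (Qmat A C R N + Hmat A C R N).mulVec (η - xt) =
      (z - xt) ⬝ᵥ (Qmat A C R N).mulVec (z - xt) := by
  have hdet := isUnit_det_Qmat_succ A C N hW R hR
  rw [← Qmat_add_Hmat A C R hN] at hdet
  have hRt : Rᵀ = R := by simpa using hR.isHermitian.eq
  have hnormal : (Qmat A C R N + Hmat A C R N).mulVec (η - xt) =
      (Qmat A C R N).mulVec (z - xt) := by
    have hη' : (Qmat A C R N + Hmat A C R N).mulVec η =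
        (Hmat A C R N).mulVec xt + (Qmat A C R N).mulVec z := by
      rw [hη, hy, Matrix.mulVec_add, Matrix.mulVec_mulVec, Matrix.mulVec_mulVec,
        Matrix.mulVec_mulVec]
      simp only [Matrix.mul_assoc, Matrix.mul_nonsing_inv_cancel_left _ _ hdet]
      simp only [Hmat, Matrix.mul_assoc]
    rw [Matrix.mulVec_sub, hη', Matrix.add_mulVec, Matrix.mulVec_sub]
    abel
  have hJ : Jcost A C R N η z y = (η - xt) ⬝ᵥ (Hmat A C R N).mulVec (η - xt) +
      (η - z) ⬝ᵥ (Qmat A C R N).mulVec (η - z) := by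
    simp only [Jcost, hy, ← Matrix.mulVec_sub, dotProduct_Qmat_mulVec, Hmat,
      dotProduct_gram_mulVec]
  have hsymm : (z - xt) ⬝ᵥ (Qmat A C R N).mulVec (η - xt) =
      (η - xt) ⬝ᵥ (Qmat A C R N).mulVec (z - xt) := by
    rw [Matrix.dotProduct_mulVec, ← Matrix.mulVec_transpose, Qmat_transpose A C R hRt,
      dotProduct_comm]
  have hdot := congrArg (fun w => (η - xt) ⬝ᵥ w) hnormal
  simp only [Matrix.add_mulVec, dotProduct_add] at hdot
  rw [hJ, ← sub_sub_sub_cancel_right η z xt, Matrix.add_mulVec]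
  rw [Matrix.mulVec_sub _ (η - xt) (z - xt)]
  simp only [dotProduct_add, dotProduct_sub, sub_dotProduct (η - xt) (z - xt)]
  linarith
end

section
/- Let (X, ρ_x) and (Y, ρ_y) be complete metric spaces, f : X → X and h : X → Y uniformly continuous, N ≥ 2 an integer, and ℓ : Y × Y → ℝ_{≥0} a symmetric function satisfying α₁(ρ_y(v,w)) ≤ ℓ(v,w) ≤ α₂(ρ_y(v,w)) for all v, w ∈ Y, with α₁, α₂ ∈ K∞. Define J(ξ, z, y) := ℓ(h(f^{N−1}(ξ)), y) + Σ_{i=0}^{N−2} ℓ(h(f^i(ξ)), h(f^i(z))). Assume there exists α₃ ∈ K∞ with Σ_{i=0}^{N−1} ℓ(h(f^i(z)), h(f^i(x̃))) ≥ α₃(ρ_x(z, x̃)) for all z, x̃ ∈ X. Then there exists α₇ ∈ K∞ such that whenever x ∈ X, z ∈ X, y := h(x), η minimizes ξ ↦ J(ξ, z, y), x̂ := f^{N−1}(z), x⁺ := f(x), z⁺ := f(η), and x̂⁺ := f^{N−1}(z⁺), one has ρ_x(x̂⁺, x⁺) ≤ α₇(ρ_x(x̂, x)). -/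
open Filter Finset

/-- A function `α : ℝ≥0 → ℝ≥0` of class `K∞`: continuous, zero at zero, strictly
increasing, and unbounded (modelled on `ℝ`, restricted to `[0, ∞)`). -/
def IsKInf (α : ℝ → ℝ) : Prop :=
  ContinuousOn α (Set.Ici 0) ∧ α 0 = 0 ∧ StrictMonoOn α (Set.Ici 0) ∧
    Tendsto α atTop atTop

/-- The cost `J(ξ, z, y) = ℓ(h f^{N-1} ξ, y) + Σ_{i=0}^{N-2} ℓ(h f^i ξ, h f^i z)`. -/
def Jnl {X Y : Type*} (f : X → X) (h : X → Y) (ℓ : Y → Y → ℝ) (N : ℕ)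
    (ξ z : X) (y : Y) : ℝ :=
  ℓ (h (f^[N - 1] ξ)) y + ∑ i ∈ Finset.range (N - 1), ℓ (h (f^[i] ξ)) (h (f^[i] z))

namespace IsKInf

variable {α β : ℝ → ℝ}

theorem monotoneOn (hα : IsKInf α) : MonotoneOn α (Set.Ici 0) :=
  hα.2.2.1.monotoneOn

theorem mono (hα : IsKInf α) {s t : ℝ} (hs : 0 ≤ s) (hst : s ≤ t) : α s ≤ α t :=
  hα.monotoneOn hs (hs.trans hst) hst

theorem nonneg (hα : IsKInf α) {s : ℝ} (hs : 0 ≤ s) : 0 ≤ α s :=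
  hα.2.1.symm.le.trans (hα.mono le_rfl hs)

theorem mapsTo (hα : IsKInf α) : Set.MapsTo α (Set.Ici 0) (Set.Ici 0) :=
  fun _ hs => hα.nonneg hs

theorem id : IsKInf fun s => s :=
  ⟨continuousOn_id, rfl, strictMonoOn_id, tendsto_id⟩

theorem add (hα : IsKInf α) (hβ : IsKInf β) : IsKInf fun s => α s + β s :=
  ⟨hα.1.add hβ.1, by simp [hα.2.1, hβ.2.1], hα.2.2.1.add hβ.2.2.1,
    hα.2.2.2.atTop_add_atTop hβ.2.2.2⟩

theorem comp (hα : IsKInf α) (hβ : IsKInf β) : IsKInf fun s => α (β s) :=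
  ⟨hα.1.comp hβ.1 hβ.mapsTo, by simp [hα.2.1, hβ.2.1], hα.2.2.1.comp hβ.2.2.1 hβ.mapsTo,
    hα.2.2.2.comp hβ.2.2.2⟩

theorem iterate (hα : IsKInf α) (n : ℕ) : IsKInf α^[n] := by
  induction n with
  | zero => exact IsKInf.id
  | succ n ih => exact ih.comp hα

theorem exists_eq (hα : IsKInf α) {t : ℝ} (ht : 0 ≤ t) : ∃ s, 0 ≤ s ∧ α s = t := by
  obtain ⟨b, hb, hb0⟩ :=
    ((hα.2.2.2.eventually_ge_atTop t).and (eventually_ge_atTop 0)).exists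
  obtain ⟨s, hs, rfl⟩ := intermediate_value_Icc hb0 (hα.1.mono Set.Icc_subset_Ici_self)
    (show t ∈ Set.Icc (α 0) (α b) from ⟨hα.2.1.trans_le ht, hb⟩)
  exact ⟨s, hs.1, rfl⟩

/-- Bounds on `α s` transfer to bounds on `s` through a class-`K∞` function, the inverse of `α`. -/
theorem exists_le_of_apply_le (hα : IsKInf α) :
    ∃ β, IsKInf β ∧ ∀ s t, 0 ≤ s → α s ≤ t → s ≤ β t := by
  let e : Set.Ici (0 : ℝ) ≃o Set.Ici (0 : ℝ) :=
    StrictMono.orderIsoOfSurjective (fun s => ⟨α s, hα.mapsTo s.2⟩)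
      (fun s t hst => hα.2.2.1 s.2 t.2 hst)
      (fun t => by
        obtain ⟨s, hs, h⟩ := hα.exists_eq t.2
        exact ⟨⟨s, hs⟩, Subtype.ext h⟩)
  have key (s t : ℝ) (hs : 0 ≤ s) (hst : α s ≤ t) :
      s ≤ e.symm (Set.projIci 0 t) := by
    have : (⟨s, hs⟩ : Set.Ici (0 : ℝ)) ≤ e.symm (Set.projIci 0 t) := by
      rw [OrderIso.le_symm_apply]
      exact hst.trans (le_max_right _ _)
    exact this
  refine ⟨fun t => e.symm (Set.projIci 0 t), ⟨?_, ?_, ?_, ?_⟩, key⟩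
  · exact (continuous_subtype_val.comp
      (e.symm.continuous.comp
        ((continuous_const.max continuous_id).subtype_mk _))).continuousOn
  · have h : Set.projIci (0 : ℝ) 0 = e ⟨0, Set.self_mem_Ici⟩ := by
      rw [Set.projIci_self]
      exact Subtype.ext hα.2.1.symm
    simp only [h, OrderIso.symm_apply_apply]
  · intro s hs t ht hst
    exact e.symm.strictMono (Set.strictMonoOn_projIci hs ht hst)
  · refine tendsto_atTop.2 fun b => ?_
    filter_upwards [eventually_ge_atTop (α (max b 0))] with t ht
    exact (le_max_left _ _).trans (key _ _ (le_max_right _ _) ht)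

/-- A modulus of continuity of `f` iterates along with `f`. -/
theorem dist_iterate_le {X : Type*} [PseudoMetricSpace X] {f : X → X} (hα : IsKInf α)
    (hf : ∀ ξ ζ, dist (f ξ) (f ζ) ≤ α (dist ξ ζ)) (n : ℕ) (ξ ζ : X) :
    dist (f^[n] ξ) (f^[n] ζ) ≤ α^[n] (dist ξ ζ) := by
  induction n generalizing ξ ζ with
  | zero => exact le_rfl
  | succ n ih =>
    exact (ih (f ξ) (f ζ)).trans ((hα.iterate n).mono dist_nonneg (hf ξ ζ))

end IsKInf

/-- **One-step stability bound (eqn. `eqn:boundedness4`).**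
There is `α₇ ∈ K∞` such that for any state `x`, observer state `z`, and
minimizer `η` of `ξ ↦ J(ξ, z, h x)`, the next estimation error is bounded:
`ρ_x(x̂⁺, x⁺) ≤ α₇(ρ_x(x̂, x))`, where `x̂ = f^{N-1} z`, `x⁺ = f x`,
`z⁺ = f η`, `x̂⁺ = f^{N-1} z⁺`. -/
theorem stmt_14 {X Y : Type*} [MetricSpace X] [MetricSpace Y]
    [CompleteSpace X] [CompleteSpace Y]
    (f : X → X) (h : X → Y) (hf : UniformContinuous f) (hh : UniformContinuous h)
    (N : ℕ) (hN : 2 ≤ N)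
    (ℓ : Y → Y → ℝ) (hsym : ∀ v w, ℓ v w = ℓ w v)
    (α₁ α₂ : ℝ → ℝ) (hα₁ : IsKInf α₁) (hα₂ : IsKInf α₂)
    (hℓ : ∀ v w, α₁ (dist v w) ≤ ℓ v w ∧ ℓ v w ≤ α₂ (dist v w))
    (α₃ : ℝ → ℝ) (hα₃ : IsKInf α₃)
    (hobs : ∀ z xt : X, α₃ (dist z xt) ≤ ∑ i ∈ Finset.range N, ℓ (h (f^[i] z)) (h (f^[i] xt)))
    (α₅ α₆ : ℝ → ℝ) (hα₅ : IsKInf α₅) (hα₆ : IsKInf α₆)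
    (hfmod : ∀ ξ ζ : X, dist (f ξ) (f ζ) ≤ α₅ (dist ξ ζ))
    (hhmod : ∀ ξ ζ : X, dist (h ξ) (h ζ) ≤ α₆ (dist ξ ζ)) :
    ∃ α₇ : ℝ → ℝ, IsKInf α₇ ∧
      ∀ (x z η : X), (∀ ξ : X, Jnl f h ℓ N η z (h x) ≤ Jnl f h ℓ N ξ z (h x)) →
        dist (f^[N - 1] (f η)) (f x) ≤ α₇ (dist (f^[N - 1] z) x) := by
  obtain ⟨β₁, hβ₁, hβ₁_le⟩ := hα₁.exists_le_of_apply_le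
  obtain ⟨β₃, hβ₃, hβ₃_le⟩ := hα₃.exists_le_of_apply_le
  have hcost := hα₂.comp hα₆
  have hgap := hα₂.comp ((hβ₁.comp hcost).add hα₆)
  refine ⟨_, ((hα₅.iterate N).comp (hβ₃.comp (hcost.add hgap))).add hα₅, ?_⟩
  intro x z η hη
  obtain ⟨n, rfl⟩ : ∃ n, N = n + 1 := ⟨N - 1, by omega⟩
  simp only [Nat.add_sub_cancel, Jnl] at hη ⊢
  have hℓ_nonneg (v w : Y) : 0 ≤ ℓ v w := (hα₁.nonneg dist_nonneg).trans (hℓ v w).1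
  have hℓ_self (v : Y) : ℓ v v = 0 :=
    le_antisymm (by simpa [hα₂.2.1] using (hℓ v v).2) (hℓ_nonneg v v)
  set δ := dist (f^[n] z) x
  have hJ : ℓ (h (f^[n] η)) (h x) + ∑ i ∈ range n, ℓ (h (f^[i] η)) (h (f^[i] z))
      ≤ α₂ (α₆ δ) := by
    refine (hη z).trans ?_
    simp only [hℓ_self, sum_const_zero, add_zero]
    exact (hℓ _ _).2.trans (hα₂.mono dist_nonneg (hhmod _ _))
  have hsum_nonneg : 0 ≤ ∑ i ∈ range n, ℓ (h (f^[i] η)) (h (f^[i] z)) :=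
    sum_nonneg fun _ _ => hℓ_nonneg _ _
  have hout : dist (h (f^[n] η)) (h x) ≤ β₁ (α₂ (α₆ δ)) :=
    hβ₁_le _ _ dist_nonneg ((hℓ _ _).1.trans (by linarith))
  have hlast : ℓ (h (f^[n] η)) (h (f^[n] z)) ≤ α₂ (β₁ (α₂ (α₆ δ)) + α₆ δ) := by
    refine (hℓ _ _).2.trans (hα₂.mono dist_nonneg ?_)
    refine (dist_triangle_right _ _ (h x)).trans (add_le_add hout (hhmod _ _))
  have hdist : dist η z ≤ β₃ (α₂ (α₆ δ) + α₂ (β₁ (α₂ (α₆ δ)) + α₆ δ)) := by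
    refine hβ₃_le _ _ dist_nonneg ((hobs η z).trans ?_)
    rw [sum_range_succ]
    linarith [hℓ_nonneg (h (f^[n] η)) (h x)]
  have hstep : dist (f^[n + 1] z) (f x) ≤ α₅ δ := by
    rw [Function.iterate_succ_apply']
    exact hfmod _ _
  calc dist (f^[n + 1] η) (f x)
      ≤ dist (f^[n + 1] η) (f^[n + 1] z) + dist (f^[n + 1] z) (f x) := dist_triangle _ _ _
    _ ≤ _ := add_le_add ((hα₅.dist_iterate_le hfmod _ _ _).trans
        ((hα₅.iterate _).mono dist_nonneg hdist)) hstep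
end
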